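/- arXiv:2306.11625 — 2 statements merged into one kernel-verified Lean document; each statement's English description precedes it below -/
import Mathlib

section
/- (Pointwise nonvanishing of the MPI signal) Let β, μ₀, m₀ > 0, let G be an invertible real 3×3 matrix, let Ω ⊂ ℝ³ be a bounded Lebesgue-measurable set with positive Lebesgue measure, let b ∈ ℝ³, let w ∈ ℝ³ with w ≠ 0, and let R₁, R₂, R₃ ∈ ℝ³ span ℝ³. Then the vector in ℝ³ whose i-th component is −μ₀ m₀ ∫_Ω R_iᵀ F̃(G(x − b)) G w dx (with F̃ extended to ξ = 0 by (β/3)·I₃) is nonzero. -/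
open MeasureTheory Filter Matrix
open scoped Topology

/-- The hyperbolic cotangent `coth y = cosh y / sinh y`. -/
noncomputable def coth (y : ℝ) : ℝ := Real.cosh y / Real.sinh y

/-- The dilated Langevin function `L_β`: `L_β z = coth (β z) - 1/(β z)` for `z ≠ 0`, `L_β 0 = 0`. -/
noncomputable def Lb (β z : ℝ) : ℝ := if z = 0 then 0 else coth (β * z) - 1 / (β * z)

/-- `L'_β z = 1/(β z²) - β/(sinh (β z))²` (the derivative of `L_β` away from `0`). -/
noncomputable def Lb' (β z : ℝ) : ℝ := 1 / (β * z ^ 2) - β / (Real.sinh (β * z)) ^ 2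

/-- The Euclidean norm on `ℝ³`. -/
noncomputable def enorm3 (ξ : Fin 3 → ℝ) : ℝ := Real.sqrt (∑ i, ξ i ^ 2)

/-- The matrix `F̃(ξ) = (L'_β(‖ξ‖)/‖ξ‖² − L_β(‖ξ‖)/‖ξ‖³)·ξξᵀ + (L_β(‖ξ‖)/‖ξ‖)·I₃` for `ξ ≠ 0`,
extended to `ξ = 0` by `(β/3)·I₃`. -/
noncomputable def Ftilde (β : ℝ) (ξ : Fin 3 → ℝ) : Matrix (Fin 3) (Fin 3) ℝ :=
  if ξ = 0 then (β / 3) • (1 : Matrix (Fin 3) (Fin 3) ℝ)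
  else (Lb' β (enorm3 ξ) / (enorm3 ξ) ^ 2 - Lb β (enorm3 ξ) / (enorm3 ξ) ^ 3) •
        Matrix.of (fun i j => ξ i * ξ j)
      + (Lb β (enorm3 ξ) / enorm3 ξ) • (1 : Matrix (Fin 3) (Fin 3) ℝ)

lemma cosh_sub_one_le_mul_sinh {y : ℝ} (hy : 0 < y) : Real.cosh y - 1 ≤ y * Real.sinh y := by
  obtain ⟨c, hc, h⟩ := exists_deriv_eq_slope Real.cosh hy Real.continuous_cosh.continuousOn
    Real.differentiable_cosh.differentiableOn
  rw [Real.deriv_cosh, Real.cosh_zero, sub_zero, eq_div_iff hy.ne'] at h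
  have := Real.sinh_strictMono hc.2
  nlinarith

lemma sinh_lt_mul_cosh {y : ℝ} (hy : 0 < y) : Real.sinh y < y * Real.cosh y := by
  obtain ⟨c, hc, h⟩ := exists_deriv_eq_slope Real.sinh hy Real.continuous_sinh.continuousOn
    Real.differentiable_sinh.differentiableOn
  rw [Real.deriv_sinh, Real.sinh_zero, sub_zero, sub_zero, eq_div_iff hy.ne'] at h
  have : Real.cosh c < Real.cosh y := by
    rw [Real.cosh_lt_cosh, abs_of_pos hc.1, abs_of_pos hy]
    exact hc.2
  nlinarith

lemma Lb_eq_div {β z : ℝ} (hβ : 0 < β) (hz : 0 < z) :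
    Lb β z = (β * z * Real.cosh (β * z) - Real.sinh (β * z)) / (β * z * Real.sinh (β * z)) := by
  have hs : Real.sinh (β * z) ≠ 0 := (Real.sinh_pos_iff.2 (mul_pos hβ hz)).ne'
  rw [Lb, if_neg hz.ne', coth]
  field_simp

lemma Lb_pos {β z : ℝ} (hβ : 0 < β) (hz : 0 < z) : 0 < Lb β z := by
  have hy := mul_pos hβ hz
  have hs := Real.sinh_pos_iff.2 hy
  rw [Lb_eq_div hβ hz]
  exact div_pos (sub_pos.2 (sinh_lt_mul_cosh hy)) (mul_pos hy hs)

lemma Lb_le {β z : ℝ} (hβ : 0 < β) (hz : 0 < z) : Lb β z ≤ β * z := by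
  have hy := mul_pos hβ hz
  have hs := Real.sinh_pos_iff.2 hy
  rw [Lb_eq_div hβ hz, div_le_iff₀ (mul_pos hy hs)]
  have h1 := cosh_sub_one_le_mul_sinh hy
  have h2 := Real.self_lt_sinh_iff.2 hy
  nlinarith

lemma Lb'_eq_div {β z : ℝ} (hβ : 0 < β) (hz : 0 < z) :
    Lb' β z = β * (Real.sinh (β * z) ^ 2 - (β * z) ^ 2) /
      ((β * z) ^ 2 * Real.sinh (β * z) ^ 2) := by
  have hs : Real.sinh (β * z) ≠ 0 := (Real.sinh_pos_iff.2 (mul_pos hβ hz)).ne'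
  rw [Lb']
  field_simp

lemma Lb'_pos {β z : ℝ} (hβ : 0 < β) (hz : 0 < z) : 0 < Lb' β z := by
  have hy := mul_pos hβ hz
  have hs := Real.self_lt_sinh_iff.2 hy
  rw [Lb'_eq_div hβ hz]
  have : 0 < Real.sinh (β * z) := hy.trans hs
  have : (β * z) ^ 2 < Real.sinh (β * z) ^ 2 := by gcongr
  have := sub_pos.2 this
  positivity

lemma Lb'_le {β z : ℝ} (hβ : 0 < β) (hz : 0 < z) : Lb' β z ≤ 2 * β := by
  have hy := mul_pos hβ hz
  have hs := Real.self_lt_sinh_iff.2 hy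
  have hs0 : 0 < Real.sinh (β * z) := hy.trans hs
  rw [Lb'_eq_div hβ hz, div_le_iff₀ (by positivity)]
  have h1 := cosh_sub_one_le_mul_sinh hy
  have h2 := sinh_lt_mul_cosh hy
  generalize Real.sinh (β * z) = s at *
  generalize Real.cosh (β * z) = c at *
  generalize β * z = y at *
  have h3 : s - y ≤ y * (y * s) := by nlinarith
  have h4 : (s - y) * (s + y) ≤ y * (y * s) * (2 * s) :=
    mul_le_mul h3 (by linarith) (by linarith) (by positivity)
  nlinarith

lemma enorm3_sq (ξ : Fin 3 → ℝ) : enorm3 ξ ^ 2 = ∑ i, ξ i ^ 2 :=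
  Real.sq_sqrt (Finset.sum_nonneg fun _ _ => sq_nonneg _)

lemma enorm3_pos {ξ : Fin 3 → ℝ} (hξ : ξ ≠ 0) : 0 < enorm3 ξ := by
  obtain ⟨i, hi⟩ := Function.ne_iff.1 hξ
  exact Real.sqrt_pos.2 (Finset.sum_pos' (fun _ _ => sq_nonneg _)
    ⟨i, Finset.mem_univ i, by simpa [sq_pos_iff] using hi⟩)

lemma abs_le_enorm3 (ξ : Fin 3 → ℝ) (i : Fin 3) : |ξ i| ≤ enorm3 ξ :=
  Real.abs_le_sqrt (Finset.single_le_sum (f := fun i => ξ i ^ 2)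
    (fun _ _ => sq_nonneg _) (Finset.mem_univ i))

/-- `F̃(ξ)` is positive definite. -/
lemma Ftilde_quadratic_pos {β : ℝ} (hβ : 0 < β) (ξ : Fin 3 → ℝ) {v : Fin 3 → ℝ} (hv : v ≠ 0) :
    0 < v ⬝ᵥ (Ftilde β ξ).mulVec v := by
  have hn : 0 < v ⬝ᵥ v := 
    lt_of_le_of_ne (Finset.sum_nonneg fun i _ => mul_self_nonneg (v i))
      (Ne.symm (dotProduct_self_eq_zero.not.2 hv))
  rw [Ftilde]
  split_ifs with h
  · rw [smul_mulVec, one_mulVec, dotProduct_smul, smul_eq_mul]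
    positivity
  · have hr := enorm3_pos h
    have hsq := enorm3_sq ξ
    have ha := Lb'_pos hβ hr
    have hl := Lb_pos hβ hr
    generalize Lb' β (enorm3 ξ) = a at *
    generalize Lb β (enorm3 ξ) = l at *
    generalize enorm3 ξ = r at *
    have key : v ⬝ᵥ ((a / r ^ 2 - l / r ^ 3) • Matrix.of (fun i j => ξ i * ξ j)
        + (l / r) • (1 : Matrix (Fin 3) (Fin 3) ℝ)).mulVec v =
        a / r ^ 2 * (ξ ⬝ᵥ v) ^ 2 + l / r ^ 3 * (r ^ 2 * (v ⬝ᵥ v) - (ξ ⬝ᵥ v) ^ 2) := by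
      have : l / r = l / r ^ 3 * r ^ 2 := by field_simp
      rw [add_mulVec, smul_mulVec, smul_mulVec, one_mulVec, dotProduct_add, dotProduct_smul,
        dotProduct_smul, this]
      simp only [dotProduct, mulVec, Fin.sum_univ_three, of_apply, smul_eq_mul]
      ring
    have cs : (ξ ⬝ᵥ v) ^ 2 ≤ r ^ 2 * (v ⬝ᵥ v) := by
      rw [hsq]
      simpa only [dotProduct, sq] using Finset.sum_mul_sq_le_sq_mul_sq Finset.univ ξ v
    rw [key]
    rcases eq_or_ne (ξ ⬝ᵥ v) 0 with h0 | h0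
    · rw [h0]
      have : 0 < l / r ^ 3 * (r ^ 2 * (v ⬝ᵥ v)) := by positivity
      linarith
    · exact add_pos_of_pos_of_nonneg (by positivity)
        (mul_nonneg (by positivity) (sub_nonneg.2 cs))

lemma abs_Ftilde_apply_le {β : ℝ} (hβ : 0 < β) (ξ : Fin 3 → ℝ) (i j : Fin 3) :
    |Ftilde β ξ i j| ≤ 4 * β := by
  have hone : |(1 : Matrix (Fin 3) (Fin 3) ℝ) i j| ≤ 1 := by
    rw [one_apply]
    split_ifs <;> simp
  rw [Ftilde]
  split_ifs with h
  · rw [Matrix.smul_apply, smul_eq_mul, abs_mul, abs_of_pos (by positivity : 0 < β / 3)]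
    nlinarith
  · have hr := enorm3_pos h
    have hi := abs_le_enorm3 ξ i
    have hj := abs_le_enorm3 ξ j
    have ha := Lb'_pos hβ hr
    have hl := Lb_pos hβ hr
    have ha' := Lb'_le hβ hr
    have hl' := Lb_le hβ hr
    generalize Lb' β (enorm3 ξ) = a at *
    generalize Lb β (enorm3 ξ) = l at *
    generalize enorm3 ξ = r at *
    have hq : |ξ i * ξ j / r ^ 2| ≤ 1 := by
      rw [abs_div, abs_mul, abs_of_pos (pow_pos hr 2), div_le_one (pow_pos hr 2), sq]
      exact mul_le_mul hi hj (abs_nonneg _) hr.le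
    have hlr : l / r ≤ β := by rwa [div_le_iff₀ hr]
    have hlr0 : 0 < l / r := div_pos hl hr
    have hc : |a - l / r| ≤ 3 * β := by
      rw [abs_le]
      constructor <;> linarith
    have heq : ((a / r ^ 2 - l / r ^ 3) • Matrix.of (fun i j => ξ i * ξ j)
        + (l / r) • (1 : Matrix (Fin 3) (Fin 3) ℝ)) i j =
        (a - l / r) * (ξ i * ξ j / r ^ 2) + l / r * (1 : Matrix (Fin 3) (Fin 3) ℝ) i j := by
      simp only [Matrix.add_apply, Matrix.smul_apply, of_apply, smul_eq_mul]
      field_simp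
    rw [heq]
    calc _ ≤ |a - l / r| * |ξ i * ξ j / r ^ 2|
          + |l / r| * |(1 : Matrix (Fin 3) (Fin 3) ℝ) i j| := by
          rw [← abs_mul, ← abs_mul]
          exact abs_add_le _ _
      _ ≤ 3 * β * 1 + β * 1 := by
          rw [abs_of_pos hlr0]
          gcongr
      _ = 4 * β := by ring

lemma measurable_Ftilde_apply (β : ℝ) (i j : Fin 3) :
    Measurable fun ξ : Fin 3 → ℝ => Ftilde β ξ i j := by
  have hr : Measurable enorm3 := by
    unfold enorm3
    fun_prop
  have hL' : Measurable (Lb' β) := by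
    unfold Lb'
    fun_prop
  have hL : Measurable (Lb β) := by
    unfold Lb coth
    exact Measurable.ite (measurableSet_singleton 0) measurable_const (by fun_prop)
  have heq : (fun ξ : Fin 3 → ℝ => Ftilde β ξ i j) = fun ξ =>
      if ξ = 0 then β / 3 * (1 : Matrix (Fin 3) (Fin 3) ℝ) i j
      else (Lb' β (enorm3 ξ) / (enorm3 ξ) ^ 2 - Lb β (enorm3 ξ) / (enorm3 ξ) ^ 3) * (ξ i * ξ j)
        + (Lb β (enorm3 ξ) / enorm3 ξ) * (1 : Matrix (Fin 3) (Fin 3) ℝ) i j := by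
    funext ξ
    rw [Ftilde]
    split_ifs <;> simp
  rw [heq]
  exact Measurable.ite (measurableSet_singleton 0) measurable_const (by fun_prop)

lemma integrableOn_dotProduct_Ftilde {β : ℝ} (hβ : 0 < β) (G : Matrix (Fin 3) (Fin 3) ℝ)
    {Ω : Set (Fin 3 → ℝ)} (hΩ : volume Ω ≠ ⊤) (b u v : Fin 3 → ℝ) :
    IntegrableOn (fun x => u ⬝ᵥ (Ftilde β (G.mulVec (x - b))).mulVec v) Ω := by
  have hG : Measurable fun x : Fin 3 → ℝ => G.mulVec (x - b) :=
    (Continuous.matrix_mulVec continuous_const (by fun_prop)).measurable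
  have hF (i j : Fin 3) : IntegrableOn (fun x => Ftilde β (G.mulVec (x - b)) i j) Ω :=
    Measure.integrableOn_of_bounded hΩ
      ((measurable_Ftilde_apply β i j).comp hG).aestronglyMeasurable
      (Eventually.of_forall fun x => abs_Ftilde_apply_le hβ _ i j)
  simp only [dotProduct, mulVec]
  exact integrable_finsetSum _ fun i _ => (integrable_finsetSum _ fun j _ =>
    (hF i j).mul_const _).const_mul _

/-- Pointwise nonvanishing of the MPI signal: for `β, μ₀, m₀ > 0`, `G` invertible,
`Ω ⊂ ℝ³` bounded measurable with positive measure, `b ∈ ℝ³`, `w ≠ 0`, and coil sensitivities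
`R₁, R₂, R₃` spanning `ℝ³`, the vector with `i`-th component
`−μ₀ m₀ ∫_Ω R_iᵀ F̃(G(x − b)) G w dx` is nonzero. -/
theorem mpi_signal_ne_zero (β μ₀ m₀ : ℝ) (hβ : 0 < β) (hμ₀ : 0 < μ₀) (hm₀ : 0 < m₀)
    (G : Matrix (Fin 3) (Fin 3) ℝ) (hG : IsUnit G.det)
    (Ω : Set (Fin 3 → ℝ)) (hΩb : Bornology.IsBounded Ω) (hΩm : MeasurableSet Ω)
    (hΩpos : 0 < volume Ω) (b : Fin 3 → ℝ) (w : Fin 3 → ℝ) (hw : w ≠ 0)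
    (R : Fin 3 → Fin 3 → ℝ) (hR : Submodule.span ℝ (Set.range R) = ⊤) :
    (fun i : Fin 3 =>
      -(μ₀ * m₀) * ∫ x in Ω, R i ⬝ᵥ (Ftilde β (G.mulVec (x - b))).mulVec (G.mulVec w)) ≠ 0 := by
  intro h
  have hv : G.mulVec w ≠ 0 := fun h0 =>
    hw (Matrix.mulVec_injective_of_isUnit ((Matrix.isUnit_iff_isUnit_det G).2 hG)
      (h0.trans (mulVec_zero G).symm))
  have hfin : volume Ω ≠ ⊤ := hΩb.measure_lt_top.ne
  have hint (u : Fin 3 → ℝ) := integrableOn_dotProduct_Ftilde hβ G hfin b u (G.mulVec w)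
  have hzero (i : Fin 3) :
      ∫ x in Ω, R i ⬝ᵥ (Ftilde β (G.mulVec (x - b))).mulVec (G.mulVec w) = 0 :=
    (mul_eq_zero.1 (congrFun h i)).resolve_left (neg_ne_zero.2 (mul_pos hμ₀ hm₀).ne')
  obtain ⟨c, hc⟩ := (Submodule.mem_span_range_iff_exists_fun ℝ).1
    (hR ▸ Submodule.mem_top : G.mulVec w ∈ Submodule.span ℝ (Set.range R))
  have hsum : ∫ x in Ω, G.mulVec w ⬝ᵥ (Ftilde β (G.mulVec (x - b))).mulVec (G.mulVec w) = 0 := by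
    conv_lhs => enter [2, x, 1]; rw [← hc]
    simp only [sum_dotProduct, smul_dotProduct, smul_eq_mul]
    rw [integral_finsetSum _ fun i _ => (hint (R i)).const_mul (c i)]
    simp only [integral_const_mul, hzero, mul_zero, Finset.sum_const_zero]
  have hpos := (setIntegral_pos_iff_support_of_nonneg_ae
    (Eventually.of_forall fun x => (Ftilde_quadratic_pos hβ (G.mulVec (x - b)) hv).le)
    (hint (G.mulVec w))).2 (by
      rwa [Function.support_eq_univ fun x => (Ftilde_quadratic_pos hβ _ hv).ne', Set.univ_inter])
  exact hpos.ne' hsum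
end

section
/- (Kernel bound) Let β, μ₀, m₀ > 0, let G be an invertible real 3×3 matrix, let I ⊂ ℝ be a compact interval, let x_s : I → ℝ³ be continuously differentiable, and let R ∈ ℝ³. Define the MPI kernel k(x,t) = −μ₀ m₀ Rᵀ F̃(G(x − x_s(t))) G ẋ_s(t) (with F̃ extended to ξ = 0 by (β/3)·I₃). Then for every t ∈ I and every x ∈ ℝ³, |k(x,t)| ≤ μ₀ m₀ ‖R‖ (β/3) ‖G‖ ‖ẋ_s(t)‖, where ‖G‖ is the Euclidean operator norm of G; in particular, k is bounded on ℝ³ × I. -/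
open MeasureTheory Filter Matrix
open scoped Topology

theorem nonneg_of_hasDerivAt_nonneg {f f' : ℝ → ℝ} (hf : ∀ x, HasDerivAt f (f' x) x)
    (h0 : f 0 = 0) (hf' : ∀ x, 0 ≤ x → 0 ≤ f' x) {x : ℝ} (hx : 0 ≤ x) : 0 ≤ f x := by
  have hmono : MonotoneOn f (Set.Ici 0) := by
    refine monotoneOn_of_deriv_nonneg (convex_Ici 0)
      (fun y _ => (hf y).continuousAt.continuousWithinAt)
      (fun y _ => (hf y).differentiableAt.differentiableWithinAt) fun y hy => ?_
    rw [(hf y).deriv]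
    exact hf' y (interior_subset hy)
  exact h0 ▸ hmono Set.self_mem_Ici hx hx

theorem sinh_le_self_mul_cosh {x : ℝ} (hx : 0 ≤ x) : Real.sinh x ≤ x * Real.cosh x := by
  have h := nonneg_of_hasDerivAt_nonneg (f := fun y => y * Real.cosh y - Real.sinh y)
    (f' := fun y => y * Real.sinh y)
    (fun y => (((hasDerivAt_id' y).mul (Real.hasDerivAt_cosh y)).sub
      (Real.hasDerivAt_sinh y)).congr_deriv (by ring))
    (by simp) (fun y hy => mul_nonneg hy (Real.sinh_nonneg_iff.2 hy)) hx
  exact sub_nonneg.1 h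

theorem self_mul_cosh_sub_sinh_le {x : ℝ} (hx : 0 ≤ x) :
    3 * (x * Real.cosh x - Real.sinh x) ≤ x ^ 2 * Real.sinh x := by
  have h := nonneg_of_hasDerivAt_nonneg
    (f := fun y => y ^ 2 * Real.sinh y - 3 * (y * Real.cosh y - Real.sinh y))
    (f' := fun y => y * (y * Real.cosh y - Real.sinh y))
    (fun y => (((hasDerivAt_pow 2 y).mul (Real.hasDerivAt_sinh y)).sub
      ((((hasDerivAt_id' y).mul (Real.hasDerivAt_cosh y)).sub
        (Real.hasDerivAt_sinh y)).const_mul 3)).congr_deriv (by push_cast; ring))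
    (by simp) (fun y hy => mul_nonneg hy (sub_nonneg.2 (sinh_le_self_mul_cosh hy))) hx
  exact sub_nonneg.1 h

theorem sq_mul_cosh_add_nonneg {x : ℝ} (hx : 0 ≤ x) :
    0 ≤ x ^ 2 * Real.cosh x - 12 * Real.cosh x + 12 + 5 * x ^ 2 := by
  have hS := Real.hasDerivAt_sinh
  have hC := Real.hasDerivAt_cosh
  have hd2 : ∀ y : ℝ, 0 ≤ y →
      0 ≤ y ^ 2 * Real.cosh y + 4 * (y * Real.sinh y) - 10 * Real.cosh y + 10 := fun y hy =>
    nonneg_of_hasDerivAt_nonneg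
      (f := fun y => y ^ 2 * Real.cosh y + 4 * (y * Real.sinh y) - 10 * Real.cosh y + 10)
      (f' := fun y => y ^ 2 * Real.sinh y + 6 * (y * Real.cosh y - Real.sinh y))
      (fun y => ((((hasDerivAt_pow 2 y).mul (hC y)).add
        (((hasDerivAt_id' y).mul (hS y)).const_mul 4)).sub
        ((hC y).const_mul 10)).add_const 10 |>.congr_deriv (by push_cast; ring))
      (by simp)
      (fun y hy => by
        have h1 := sinh_le_self_mul_cosh hy
        have h2 := mul_nonneg (sq_nonneg y) (Real.sinh_nonneg_iff.2 hy)
        linarith) hy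
  have hd1 : ∀ y : ℝ, 0 ≤ y →
      0 ≤ y ^ 2 * Real.sinh y + 2 * (y * Real.cosh y) - 12 * Real.sinh y + 10 * y := fun y hy =>
    nonneg_of_hasDerivAt_nonneg
      (f := fun y => y ^ 2 * Real.sinh y + 2 * (y * Real.cosh y) - 12 * Real.sinh y + 10 * y)
      (fun y => ((((hasDerivAt_pow 2 y).mul (hS y)).add
        (((hasDerivAt_id' y).mul (hC y)).const_mul 2)).sub
        ((hS y).const_mul 12)).add ((hasDerivAt_id' y).const_mul 10)
        |>.congr_deriv (by push_cast; ring))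
      (by simp) hd2 hy
  exact nonneg_of_hasDerivAt_nonneg
    (f := fun y => y ^ 2 * Real.cosh y - 12 * Real.cosh y + 12 + 5 * y ^ 2)
    (fun y => ((((hasDerivAt_pow 2 y).mul (hC y)).sub
      ((hC y).const_mul 12)).add_const 12).add ((hasDerivAt_pow 2 y).const_mul 5)
      |>.congr_deriv (by push_cast; ring))
    (by simp) hd1 hx

theorem sinh_sq_sub_sq_le {x : ℝ} (hx : 0 ≤ x) :
    3 * (Real.sinh x ^ 2 - x ^ 2) ≤ x ^ 2 * Real.sinh x ^ 2 := by
  have h := sq_mul_cosh_add_nonneg (mul_nonneg zero_le_two hx)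
  rw [Real.cosh_two_mul, Real.cosh_sq] at h
  linarith

theorem Lb_div_nonneg {β r : ℝ} (hβ : 0 < β) (hr : 0 < r) : 0 ≤ Lb β r / r := by
  have hy : 0 < β * r := mul_pos hβ hr
  have hs : 0 < Real.sinh (β * r) := Real.sinh_pos_iff.2 hy
  rw [Lb, if_neg hr.ne', coth]
  refine div_nonneg (sub_nonneg.2 ?_) hr.le
  rw [div_le_div_iff₀ hy hs]
  linarith [sinh_le_self_mul_cosh hy.le]

theorem Lb_div_le {β r : ℝ} (hβ : 0 < β) (hr : 0 < r) : Lb β r / r ≤ β / 3 := by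
  have hy : 0 < β * r := mul_pos hβ hr
  have hs : 0 < Real.sinh (β * r) := Real.sinh_pos_iff.2 hy
  rw [Lb, if_neg hr.ne', coth, div_le_iff₀ hr, div_sub_div _ _ hs.ne' hy.ne',
    div_le_iff₀ (mul_pos hs hy)]
  linarith [self_mul_cosh_sub_sinh_le hy.le]

theorem Lb'_nonneg {β r : ℝ} (hβ : 0 < β) (hr : 0 < r) : 0 ≤ Lb' β r := by
  have hy : 0 < β * r := mul_pos hβ hr
  have hs : 0 < Real.sinh (β * r) := Real.sinh_pos_iff.2 hy
  rw [Lb', sub_nonneg, div_le_div_iff₀ (by positivity) (by positivity)]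
  have h := pow_le_pow_left₀ hy.le (Real.self_le_sinh_iff.2 hy.le) 2
  linarith

theorem Lb'_le_s15 {β r : ℝ} (hβ : 0 < β) (hr : 0 < r) : Lb' β r ≤ β / 3 := by
  have hy : 0 < β * r := mul_pos hβ hr
  have hs : 0 < Real.sinh (β * r) := Real.sinh_pos_iff.2 hy
  have h := sinh_sq_sub_sq_le hy.le
  rw [Lb', div_sub_div _ _ (by positivity) (by positivity),
    div_le_div_iff₀ (by positivity) (by norm_num)]
  linarith

theorem enorm3_eq_norm (v : Fin 3 → ℝ) : enorm3 v = ‖WithLp.toLp 2 v‖ := by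
  simp [enorm3, EuclideanSpace.norm_eq]

theorem enorm3_sq_s15 (v : Fin 3 → ℝ) : enorm3 v ^ 2 = v ⬝ᵥ v := by
  rw [enorm3, Real.sq_sqrt (by positivity)]
  simp [dotProduct, sq]

theorem enorm3_nonneg (v : Fin 3 → ℝ) : 0 ≤ enorm3 v := Real.sqrt_nonneg _

theorem enorm3_pos_s15 {v : Fin 3 → ℝ} (hv : v ≠ 0) : 0 < enorm3 v := by
  simpa [enorm3_eq_norm] using hv

theorem abs_dotProduct_le_enorm3 (u v : Fin 3 → ℝ) : |u ⬝ᵥ v| ≤ enorm3 u * enorm3 v := by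
  rw [enorm3_eq_norm, enorm3_eq_norm, mul_comm]
  simpa [EuclideanSpace.inner_eq_star_dotProduct] using
    abs_real_inner_le_norm (WithLp.toLp 2 v) (WithLp.toLp 2 u)

theorem enorm3_mulVec_le (A : Matrix (Fin 3) (Fin 3) ℝ) (v : Fin 3 → ℝ) :
    enorm3 (A.mulVec v) ≤ ‖Matrix.toEuclideanCLM (𝕜 := ℝ) A‖ * enorm3 v := by
  rw [enorm3_eq_norm, enorm3_eq_norm, ← Matrix.toEuclideanCLM_toLp]
  exact ContinuousLinearMap.le_opNorm _ _

theorem Ftilde_mulVec {β : ℝ} {ξ : Fin 3 → ℝ} (hξ : ξ ≠ 0) (w : Fin 3 → ℝ) :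
    (Ftilde β ξ).mulVec w =
      ((Lb' β (enorm3 ξ) - Lb β (enorm3 ξ) / enorm3 ξ) * (ξ ⬝ᵥ w) / enorm3 ξ ^ 2) • ξ
        + (Lb β (enorm3 ξ) / enorm3 ξ) • w := by
  have hr := (enorm3_pos_s15 hξ).ne'
  have hof : (Matrix.of fun i j => ξ i * ξ j).mulVec w = (ξ ⬝ᵥ w) • ξ := by
    ext i
    simp only [Matrix.mulVec, dotProduct, Matrix.of_apply, Pi.smul_apply, smul_eq_mul,
      Finset.sum_mul]
    exact Finset.sum_congr rfl fun j _ => by ring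
  rw [Ftilde, if_neg hξ, Matrix.add_mulVec, Matrix.smul_mulVec, Matrix.smul_mulVec,
    Matrix.one_mulVec, hof, smul_smul]
  congr 2
  field_simp

theorem enorm3_Ftilde_mulVec_le {β : ℝ} (hβ : 0 < β) (ξ w : Fin 3 → ℝ) :
    enorm3 ((Ftilde β ξ).mulVec w) ≤ β / 3 * enorm3 w := by
  have hw := enorm3_nonneg w
  refine le_of_sq_le_sq ?_ (by positivity)
  rw [mul_pow, enorm3_sq_s15, enorm3_sq_s15]
  by_cases hξ : ξ = 0
  · rw [Ftilde, if_pos hξ, Matrix.smul_mulVec, Matrix.one_mulVec, smul_dotProduct,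
      dotProduct_smul, smul_eq_mul, smul_eq_mul]
    exact (by ring : _ = _).le
  have hr := enorm3_pos_s15 hξ
  have hp := pow_le_pow_left₀ (Lb'_nonneg hβ hr) (Lb'_le_s15 hβ hr) 2
  have hq := pow_le_pow_left₀ (Lb_div_nonneg hβ hr) (Lb_div_le hβ hr) 2
  rw [Ftilde_mulVec hξ]
  generalize Lb β (enorm3 ξ) / enorm3 ξ = q at *
  generalize Lb' β (enorm3 ξ) = p at *
  have hcs : (ξ ⬝ᵥ w) ^ 2 / enorm3 ξ ^ 2 ≤ w ⬝ᵥ w := by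
    rw [div_le_iff₀ (by positivity), ← enorm3_sq_s15 w, mul_comm, ← mul_pow]
    exact sq_le_sq' (neg_le_of_abs_le (abs_dotProduct_le_enorm3 ξ w))
      (le_of_abs_le (abs_dotProduct_le_enorm3 ξ w))
  have hs : 0 ≤ (ξ ⬝ᵥ w) ^ 2 / enorm3 ξ ^ 2 := by positivity
  have hexp : (((p - q) * (ξ ⬝ᵥ w) / enorm3 ξ ^ 2) • ξ + q • w) ⬝ᵥ
      (((p - q) * (ξ ⬝ᵥ w) / enorm3 ξ ^ 2) • ξ + q • w) =
      p ^ 2 * ((ξ ⬝ᵥ w) ^ 2 / enorm3 ξ ^ 2)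
        + q ^ 2 * (w ⬝ᵥ w - (ξ ⬝ᵥ w) ^ 2 / enorm3 ξ ^ 2) := by
    simp only [add_dotProduct, dotProduct_add, smul_dotProduct, dotProduct_smul, smul_eq_mul,
      dotProduct_comm w ξ, ← enorm3_sq_s15 ξ]
    field_simp
    ring
  rw [hexp]
  linarith [mul_le_mul_of_nonneg_right hp hs, mul_le_mul_of_nonneg_right hq (sub_nonneg.2 hcs)]

/-- Kernel bound: for `β, μ₀, m₀ > 0`, `G` invertible, a compact interval `[a,b]`, a
continuously differentiable trajectory `xs` with derivative `xs'`, and `R ∈ ℝ³`, the MPI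
kernel `k(x,t) = −μ₀ m₀ Rᵀ F̃(G(x − xs(t))) G xs'(t)` satisfies, for every `t ∈ [a,b]` and
every `x ∈ ℝ³`, `|k(x,t)| ≤ μ₀ m₀ ‖R‖ (β/3) ‖G‖ ‖xs'(t)‖`, where `‖G‖` is the Euclidean
operator norm of `G`. -/
theorem mpi_kernel_bound (β μ₀ m₀ : ℝ) (hβ : 0 < β) (hμ₀ : 0 < μ₀) (hm₀ : 0 < m₀)
    (G : Matrix (Fin 3) (Fin 3) ℝ) (hG : IsUnit G.det)
    (a b : ℝ) (hab : a ≤ b) (xs xs' : ℝ → Fin 3 → ℝ)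
    (hderiv : ∀ t ∈ Set.Icc a b, HasDerivWithinAt xs (xs' t) (Set.Icc a b) t)
    (hcont : ContinuousOn xs' (Set.Icc a b))
    (R : Fin 3 → ℝ) :
    ∀ t ∈ Set.Icc a b, ∀ x : Fin 3 → ℝ,
      |-(μ₀ * m₀) * (R ⬝ᵥ (Ftilde β (G.mulVec (x - xs t))).mulVec (G.mulVec (xs' t)))| ≤
        μ₀ * m₀ * enorm3 R * (β / 3) * ‖Matrix.toEuclideanCLM (𝕜 := ℝ) G‖ *
          enorm3 (xs' t) := by
  intro t _ x
  have hμm : 0 < μ₀ * m₀ := mul_pos hμ₀ hm₀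
  rw [abs_mul, abs_neg, abs_of_pos hμm]
  calc μ₀ * m₀ * |R ⬝ᵥ (Ftilde β (G.mulVec (x - xs t))).mulVec (G.mulVec (xs' t))|
      ≤ μ₀ * m₀ * (enorm3 R * (β / 3 *
          (‖Matrix.toEuclideanCLM (𝕜 := ℝ) G‖ * enorm3 (xs' t)))) := by
        refine mul_le_mul_of_nonneg_left ?_ hμm.le
        refine (abs_dotProduct_le_enorm3 _ _).trans
          (mul_le_mul_of_nonneg_left ?_ (enorm3_nonneg R))
        exact (enorm3_Ftilde_mulVec_le hβ _ _).trans
          (mul_le_mul_of_nonneg_left (enorm3_mulVec_le _ _) (by positivity))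
    _ = _ := by ring
end
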